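/- Exponential tail bound (4.17) for the cover-time kernel: let L > 1 and M = 4L. For the kernel Ḡ defined in the context, there exists a > 0 such that Ḡ(y − M, x + M) ≤ e^{−aM}·Ḡ(y, x) for all x ≥ 0 and all y ∈ ℝ. -/

import Mathlib

/-- `Ḡ(y, x - y)` for `y ≥ 0` in the cover-time problem, written as a function of `y`
and `s = x - y`: it equals `1` if `x = s + y ≤ 0` and
`e^{-(x² + y²)} ∑ₖ (x^{2k}/k!) ∑_{j ≥ k} y^{2j}/j!` if `x > 0`. -/
noncomputable def Gker0 (y s : ℝ) : ℝ :=
  if s + y ≤ 0 then 1 else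
    Real.exp (-((s + y) ^ 2 + y ^ 2)) *
      ∑' k : ℕ, ((s + y) ^ (2 * k) / (Nat.factorial k : ℝ)) *
        ∑' j : ℕ, (if k ≤ j then y ^ (2 * j) / (Nat.factorial j : ℝ) else 0)

/-- The cover-time kernel `Ḡ(y, s)` of Aldous's recursion, with `Ḡ(y, s) = Ḡ(0, s)` for
`y < 0`. -/
noncomputable def Gker (y s : ℝ) : ℝ := if 0 ≤ y then Gker0 y s else Gker0 0 s

open Real in
/-- The tangent-line bound for `(y / z) ^ m` that replaces Jensen's inequality. -/
lemma exp_mul_le_div_pow {y z : ℝ} (hy : 0 < y) (hyz : y ≤ z) (m : ℕ) :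
    exp (-2 * (z - y)) * (1 + (z - y) - (z - y) / (4 * (z * y)) * (m : ℝ) ^ 2) ≤ (y / z) ^ m := by
  have hz : 0 < z := hy.trans_le hyz
  have ht : 0 < z * y := mul_pos hz hy
  set q := √(z * y) with hq
  have hq0 : 0 < q := sqrt_pos.2 ht
  have hqq : q ^ 2 = z * y := sq_sqrt ht.le
  have hlog : log (z / y) ≤ (z - y) / q := by
    have hv : 0 < q / y := by positivity
    have hyq : y ≤ q := le_sqrt_of_sq_le (by nlinarith)
    have h := self_le_sinh_iff.2 (log_nonneg ((one_le_div hy).2 hyq))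
    rw [sinh_log hv] at h
    have h1 : z / y = (q / y) ^ 2 := by
      rw [div_pow, hqq]; field_simp
    have h2 : q / y - (q / y)⁻¹ = (z - y) / q := by
      have : z = q ^ 2 / y := by rw [hqq]; field_simp
      rw [this]; field_simp
    rw [h1, log_pow]
    push_cast
    linarith
  have hexp : (y / z) ^ m = exp (-(m * log (z / y))) := by
    rw [← inv_div z y, inv_pow, exp_neg, ← log_pow, exp_log (by positivity)]
  set u := (m : ℝ) / q with hu
  have hmu : m * log (z / y) ≤ (z - y) * (u ^ 2 / 4 + 1) := by
    calc m * log (z / y) ≤ m * ((z - y) / q) := by gcongr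
      _ = (z - y) * u := by rw [hu]; ring
      _ ≤ _ := by
        have := sub_nonneg.2 hyz
        gcongr
        nlinarith [sq_nonneg (u / 2 - 1)]
  have hu2 : (z - y) / (4 * (z * y)) * (m : ℝ) ^ 2 = (z - y) * (u ^ 2 / 4) := by
    rw [hu, div_pow, hqq]; field_simp
  rw [hexp, hu2]
  calc _ ≤ exp (-2 * (z - y)) * exp (2 * (z - y) - m * log (z / y)) := by
        gcongr
        have := add_one_le_exp (2 * (z - y) - m * log (z / y))
        nlinarith
    _ = _ := by rw [← exp_add]; ring_nf

lemma pow_mul_pow_eq_mul_div_pow {y z : ℝ} (hz : z ≠ 0) {k j : ℕ} (h : k ≤ j) :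
    z ^ (2 * k) * y ^ (2 * j) = (z * y) ^ k * (z * y) ^ j * (y / z) ^ (j - k) := by
  obtain ⟨m, rfl⟩ := Nat.exists_eq_add_of_le h
  rw [Nat.add_sub_cancel_left, div_pow]
  field_simp
  ring

lemma hasSum_pow_div_factorial (t : ℝ) :
    HasSum (fun k : ℕ => t ^ k / (k.factorial : ℝ)) (Real.exp t) := by
  rw [Real.exp_eq_exp_ℝ]
  exact NormedSpace.expSeries_div_hasSum_exp t

lemma hasSum_natCast_mul_pow_div_factorial (t : ℝ) :
    HasSum (fun k : ℕ => k * (t ^ k / (k.factorial : ℝ))) (t * Real.exp t) := by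
  rw [← hasSum_nat_add_iff' 1]
  simp only [Finset.range_one, Finset.sum_singleton, Nat.cast_zero, zero_mul, sub_zero]
  refine ((hasSum_pow_div_factorial t).mul_left t).congr_fun ?_
  intro k
  rw [Nat.factorial_succ]
  push_cast
  field_simp
  ring

lemma hasSum_natCast_sq_mul_pow_div_factorial (t : ℝ) :
    HasSum (fun k : ℕ => (k : ℝ) ^ 2 * (t ^ k / (k.factorial : ℝ)))
      ((t ^ 2 + t) * Real.exp t) := by
  rw [← hasSum_nat_add_iff' 1]
  simp only [Finset.range_one, Finset.sum_singleton, Nat.cast_zero, ne_eq, OfNat.ofNat_ne_zero,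
    not_false_eq_true, zero_pow, zero_mul, sub_zero]
  have h := ((hasSum_natCast_mul_pow_div_factorial t).add (hasSum_pow_div_factorial t)).mul_left t
  rw [show (t ^ 2 + t) * Real.exp t = t * (t * Real.exp t + Real.exp t) by ring]
  refine h.congr_fun fun k => ?_
  rw [Nat.factorial_succ]
  push_cast
  field_simp
  ring

lemma HasSum.mul_prod_real {f g : ℕ → ℝ} {a b : ℝ} (hf : HasSum f a) (hg : HasSum g b) :
    HasSum (fun p : ℕ × ℕ => f p.1 * g p.2) (a * b) :=
  hf.mul hg (summable_mul_of_summable_norm hf.summable.norm hg.summable.norm)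

/-- The total mass and the variance of the difference of two independent Poisson variables. -/
lemma hasSum_poisson_sub_sq (t α β : ℝ) :
    HasSum (fun p : ℕ × ℕ => (α - β * ((p.2 : ℝ) - p.1) ^ 2) *
        (t ^ p.1 / (p.1.factorial : ℝ) * (t ^ p.2 / (p.2.factorial : ℝ))))
      ((α - β * (2 * t)) * Real.exp (2 * t)) := by
  have h0 := hasSum_pow_div_factorial t
  have h1 := hasSum_natCast_mul_pow_div_factorial t
  have h2 := hasSum_natCast_sq_mul_pow_div_factorial t
  have h := ((h0.mul_prod_real h0).mul_left α).sub
    ((((h0.mul_prod_real h2).add (h2.mul_prod_real h0)).sub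
      ((h1.mul_prod_real h1).mul_left 2)).mul_left β)
  have hval : (α - β * (2 * t)) * Real.exp (2 * t) = α * (Real.exp t * Real.exp t) -
      β * (Real.exp t * ((t ^ 2 + t) * Real.exp t) + (t ^ 2 + t) * Real.exp t * Real.exp t -
        2 * (t * Real.exp t * (t * Real.exp t))) := by
    rw [two_mul t, Real.exp_add]
    ring
  rw [hval]
  exact h.congr_fun fun p => by ring

/-- The terms of the double series defining `Gker0`, indexed by pairs. -/
noncomputable def gkerTerm (z y : ℝ) (p : ℕ × ℕ) : ℝ :=
  if p.1 ≤ p.2 then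
    z ^ (2 * p.1) / (p.1.factorial : ℝ) * (y ^ (2 * p.2) / (p.2.factorial : ℝ)) else 0

lemma gkerTerm_nonneg (z y : ℝ) (p : ℕ × ℕ) : 0 ≤ gkerTerm z y p := by
  unfold gkerTerm
  simp only [pow_mul]
  split_ifs <;> positivity

lemma summable_gkerTerm (z y : ℝ) : Summable (gkerTerm z y) := by
  have h := ((hasSum_pow_div_factorial (z ^ 2)).mul_prod_real
    (hasSum_pow_div_factorial (y ^ 2))).summable
  refine h.of_nonneg_of_le (gkerTerm_nonneg z y) fun p => ?_
  unfold gkerTerm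
  simp only [pow_mul]
  split_ifs
  · exact le_rfl
  · positivity

lemma Gker0_eq_tsum {y s : ℝ} (h : 0 < s + y) :
    Gker0 y s = Real.exp (-((s + y) ^ 2 + y ^ 2)) * ∑' p, gkerTerm (s + y) y p := by
  rw [Gker0, if_neg h.not_ge, (summable_gkerTerm _ _).tsum_prod]
  congr 2
  ext k
  rw [← tsum_mul_left]
  simp only [gkerTerm, mul_ite, mul_zero]

/-- Chernoff's bound for the cover-time kernel. -/
lemma Gker0_le {y s : ℝ} (hy : 0 ≤ y) (hs : 0 < s) : Gker0 y s ≤ Real.exp (-s ^ 2) := by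
  have hz : 0 < s + y := by positivity
  rw [Gker0_eq_tsum hz]
  set z := s + y with hzdef
  have hsum := (hasSum_pow_div_factorial (z * y)).mul_prod_real (hasSum_pow_div_factorial (z * y))
  have hle : ∑' p, gkerTerm z y p ≤ Real.exp (z * y) * Real.exp (z * y) := by
    refine hasSum_le (fun p => ?_) (summable_gkerTerm z y).hasSum hsum
    unfold gkerTerm
    split_ifs with h
    · rw [div_mul_div_comm, div_mul_div_comm, pow_mul_pow_eq_mul_div_pow hz.ne' h]
      refine div_le_div_of_nonneg_right ?_ (by positivity)
      refine mul_le_of_le_one_right (by positivity) (pow_le_one₀ (by positivity) ?_)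
      exact div_le_one_of_le₀ (by linarith) hz.le
    · positivity
  calc _ ≤ Real.exp (-(z ^ 2 + y ^ 2)) * (Real.exp (z * y) * Real.exp (z * y)) := by gcongr
    _ = Real.exp (-s ^ 2) := by
      rw [← Real.exp_add, ← Real.exp_add, hzdef]
      ring_nf

lemma exp_le_two_mul_tsum_gkerTerm {y z : ℝ} (hy : 0 < y) (hyz : y ≤ z) :
    Real.exp (-2 * (z - y)) * Real.exp (2 * (z * y)) ≤ 2 * ∑' p, gkerTerm z y p := by
  have hz : 0 < z := hy.trans_le hyz
  have hf := (summable_gkerTerm z y).hasSum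
  have hsymm : HasSum (fun p => gkerTerm z y p + gkerTerm z y p.swap)
      (∑' p, gkerTerm z y p + ∑' p, gkerTerm z y p) :=
    hf.add ((Equiv.prodComm ℕ ℕ).hasSum_iff (f := gkerTerm z y).2 hf)
  have hterm : ∀ k j : ℕ, k ≤ j → Real.exp (-2 * (z - y)) *
      ((1 + (z - y) - (z - y) / (4 * (z * y)) * ((j : ℝ) - k) ^ 2) *
        ((z * y) ^ k / (k.factorial : ℝ) * ((z * y) ^ j / (j.factorial : ℝ)))) ≤
      gkerTerm z y (k, j) := by
    intro k j h
    have hpow := exp_mul_le_div_pow hy hyz (j - k)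
    rw [Nat.cast_sub h] at hpow
    rw [gkerTerm, if_pos h, div_mul_div_comm, div_mul_div_comm,
      pow_mul_pow_eq_mul_div_pow hz.ne' h, ← mul_assoc, mul_div_right_comm _ ((y / z) ^ (j - k)),
      mul_comm _ ((y / z) ^ (j - k))]
    exact mul_le_mul_of_nonneg_right hpow (by positivity)
  have hle := hasSum_le ?_ ((hasSum_poisson_sub_sq (z * y) (1 + (z - y))
    ((z - y) / (4 * (z * y)))).mul_left (Real.exp (-2 * (z - y)))) hsymm
  · have hhalf : (z - y) / (4 * (z * y)) * (2 * (z * y)) = (z - y) / 2 := by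
      field_simp
      norm_num
    rw [hhalf, ← two_mul] at hle
    refine le_trans ?_ hle
    gcongr
    exact le_mul_of_one_le_left (Real.exp_pos _).le (by linarith)
  · rintro ⟨k, j⟩
    rcases le_total k j with h | h
    · exact (hterm k j h).trans (le_add_of_nonneg_right (gkerTerm_nonneg _ _ _))
    · refine le_trans (le_of_eq ?_)
        ((hterm j k h).trans (le_add_of_nonneg_left (gkerTerm_nonneg z y (k, j))))
      ring

lemma le_Gker0 {y s : ℝ} (hy : 0 ≤ y) (hs : 0 ≤ s) :
    Real.exp (-s ^ 2 - 2 * s) / 2 ≤ Gker0 y s := by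
  have hle_one : Real.exp (-s ^ 2 - 2 * s) ≤ 1 := Real.exp_le_one_iff.2 (by nlinarith)
  rcases le_or_gt (s + y) 0 with h | h
  · rw [Gker0, if_pos h]
    linarith
  rw [Gker0_eq_tsum h]
  rcases hy.eq_or_lt with rfl | hy
  · have h1 : 1 ≤ ∑' p, gkerTerm (s + 0) 0 p := by
      simpa [gkerTerm] using (summable_gkerTerm (s + 0) 0).le_tsum (0, 0)
        fun p _ => gkerTerm_nonneg _ _ p
    calc _ ≤ Real.exp (-s ^ 2 - 2 * s) := by linarith [Real.exp_pos (-s ^ 2 - 2 * s)]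
      _ ≤ Real.exp (-((s + 0) ^ 2 + 0 ^ 2)) := Real.exp_le_exp.2 (by nlinarith)
      _ ≤ _ := le_mul_of_one_le_right (Real.exp_pos _).le h1
  · have hsum := exp_le_two_mul_tsum_gkerTerm hy (by linarith : y ≤ s + y)
    calc _ = Real.exp (-((s + y) ^ 2 + y ^ 2)) *
          ((Real.exp (-2 * (s + y - y)) * Real.exp (2 * ((s + y) * y))) / 2) := by
          rw [← Real.exp_add, mul_div_assoc', ← Real.exp_add]
          ring_nf
      _ ≤ _ := by
        gcongr
        linarith

lemma Gker_le {s : ℝ} (y : ℝ) (hs : 0 < s) : Gker y s ≤ Real.exp (-s ^ 2) := by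
  unfold Gker
  split_ifs with hy
  exacts [Gker0_le hy hs, Gker0_le le_rfl hs]

lemma le_Gker {s : ℝ} (y : ℝ) (hs : 0 ≤ s) : Real.exp (-s ^ 2 - 2 * s) / 2 ≤ Gker y s := by
  unfold Gker
  split_ifs with hy
  exacts [le_Gker0 hy hs, le_Gker0 le_rfl hs]

/-- Exponential tail bound (4.17) for the cover-time kernel: for `L > 1` and `M = 4L`,
there exists `a > 0` such that `Ḡ(y - M, x + M) ≤ e^{-aM} Ḡ(y, x)` for all `x ≥ 0`
and all `y ∈ ℝ`. -/
theorem cover_kernel_tail_bound (L : ℝ) (hL : 1 < L) :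
    ∃ a : ℝ, 0 < a ∧ ∀ x y : ℝ, 0 ≤ x →
      Gker (y - 4 * L) (x + 4 * L) ≤ Real.exp (-(a * (4 * L))) * Gker y x := by
  refine ⟨1, one_pos, fun x y hx => ?_⟩
  have hM : 0 < x + 4 * L := by linarith
  have htwo : (2 : ℝ) ≤ Real.exp 1 := by linarith [Real.add_one_le_exp 1]
  calc Gker (y - 4 * L) (x + 4 * L) ≤ Real.exp (-(x + 4 * L) ^ 2) := Gker_le _ hM
    _ ≤ Real.exp (-(1 * (4 * L)) + (-x ^ 2 - 2 * x) - 1) := Real.exp_le_exp.2 (by nlinarith)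
    _ = Real.exp (-(1 * (4 * L))) * (Real.exp (-x ^ 2 - 2 * x) / Real.exp 1) := by
      rw [Real.exp_sub, Real.exp_add, mul_div_assoc]
    _ ≤ Real.exp (-(1 * (4 * L))) * (Real.exp (-x ^ 2 - 2 * x) / 2) := by gcongr
    _ ≤ Real.exp (-(1 * (4 * L))) * Gker y x := by
      gcongr
      exact le_Gker y hx
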